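/- Let V and E be finite types, src, tgt : E → V, w : E → ℤ, fix a source node s, let n = |V|, and let d : ℕ → V → WithTop ℤ be the Bellman-Ford distance function. Then there exists an edge e with d (n−1) (src e) + w e < d (n−1) (tgt e) (in WithTop ℤ) if and only if there exists a negative-weight cycle reachable from s. -/

import Mathlib

namespace BFPaper

variable {V E : Type*}

/-- `IsWalk src tgt u v es` : the list of edges `es` forms a walk from `u` to `v`
in the directed multigraph given by source and target maps `src tgt : E → V`. -/
inductive IsWalk (src tgt : E → V) : V → V → List E → Prop
  | nil (u : V) : IsWalk src tgt u u []
  | cons {v : V} (e : E) {es : List E} (h : IsWalk src tgt (tgt e) v es) :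
      IsWalk src tgt (src e) v (e :: es)

/-- The weight of a walk: the sum of the weights of its edges. -/
def weight (w : E → ℤ) (es : List E) : ℤ := (es.map w).sum

/-- `v` is reachable from `s` if there is a walk from `s` to `v`. -/
def Reachable (src tgt : E → V) (s v : V) : Prop :=
  ∃ es : List E, IsWalk src tgt s v es

/-- There is a negative-weight cycle reachable from `s`. -/
def HasNegCycleFrom (src tgt : E → V) (w : E → ℤ) (s : V) : Prop :=
  ∃ (u : V) (es : List E), es ≠ [] ∧ IsWalk src tgt u u es ∧
    weight w es < 0 ∧ Reachable src tgt s u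

/-- The Bellman-Ford distance function `d : ℕ → V → WithTop ℤ`. -/
def bfDist [Fintype E] [DecidableEq V] (src tgt : E → V) (w : E → ℤ) (s : V) :
    ℕ → V → WithTop ℤ
  | 0 => fun v => if v = s then (0 : WithTop ℤ) else ⊤
  | (k+1) => fun v =>
      min (bfDist src tgt w s k v)
        (Finset.univ.inf fun e : E =>
          if tgt e = v then bfDist src tgt w s k (src e) + (w e : WithTop ℤ) else ⊤)

end BFPaper
namespace BFPaper

section Walks

variable {V E : Type*} {src tgt : E → V} {w : E → ℤ}

theorem isWalk_nil_iff {u v : V} : IsWalk src tgt u v [] ↔ u = v := by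
  constructor
  · intro h
    cases h
    rfl
  · rintro rfl
    exact .nil u

theorem isWalk_cons_iff {u v : V} {e : E} {es : List E} :
    IsWalk src tgt u v (e :: es) ↔ src e = u ∧ IsWalk src tgt (tgt e) v es := by
  constructor
  · intro h
    cases h with
    | cons _ h => exact ⟨rfl, h⟩
  · rintro ⟨rfl, h⟩
    exact .cons e h

theorem isWalk_append_iff {u v : V} {as bs : List E} :
    IsWalk src tgt u v (as ++ bs) ↔
      ∃ x, IsWalk src tgt u x as ∧ IsWalk src tgt x v bs := by
  induction as generalizing u with
  | nil => simp [isWalk_nil_iff]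
  | cons e as ih => simp [isWalk_cons_iff, ih, and_assoc]

theorem IsWalk.target_unique {u v v' : V} {es : List E}
    (h : IsWalk src tgt u v es) (h' : IsWalk src tgt u v' es) : v = v' := by
  induction h with
  | nil u => exact isWalk_nil_iff.1 h'
  | cons e _ ih => exact ih (isWalk_cons_iff.1 h').2

@[simp]
theorem weight_append (as bs : List E) : weight w (as ++ bs) = weight w as + weight w bs := by
  simp [weight]

/-- A walk with at least as many edges as there are nodes contains a cycle. -/
theorem IsWalk.exists_cycle [Fintype V] {u v : V} {es : List E}
    (h : IsWalk src tgt u v es) (hlen : Fintype.card V ≤ es.length) :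
    ∃ (x : V) (as bs cs : List E), es = as ++ bs ++ cs ∧ bs ≠ [] ∧
      IsWalk src tgt u x as ∧ IsWalk src tgt x x bs ∧ IsWalk src tgt x v cs := by
  have hsplit (i : ℕ) : ∃ x, IsWalk src tgt u x (es.take i) ∧ IsWalk src tgt x v (es.drop i) := by
    rw [← isWalk_append_iff, List.take_append_drop]
    exact h
  choose x hx using hsplit
  obtain ⟨i, j, hij, hxij⟩ : ∃ i j : Fin (es.length + 1), i < j ∧ x i = x j := by
    obtain ⟨i, j, hne, heq⟩ := Fintype.exists_ne_map_eq_of_card_lt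
      (fun i : Fin (es.length + 1) => x i) (by simpa using Nat.lt_succ_of_le hlen)
    rcases lt_or_gt_of_ne hne with hlt | hlt
    · exact ⟨i, j, hlt, heq⟩
    · exact ⟨j, i, hlt, heq.symm⟩
  have hij' : (i : ℕ) < j := hij
  have htake : es.take j = es.take i ++ (es.drop i).take (j - i) := by
    rw [← List.take_add, Nat.add_sub_cancel' hij'.le]
  refine ⟨x i, es.take i, (es.drop i).take (j - i), es.drop j, ?_, ?_, (hx i).1, ?_, ?_⟩
  · rw [← htake, List.take_append_drop]
  · intro hnil
    have := congrArg List.length hnil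
    have := j.isLt
    simp at *
    omega
  · have hj := (hx j).1
    rw [htake, isWalk_append_iff] at hj
    obtain ⟨y, hy, hmid⟩ := hj
    rwa [← hxij, hy.target_unique (hx i).1] at hmid
  · rw [hxij]
    exact (hx j).2

/-- Without reachable negative cycles, every walk from the source can be shortened to fewer
edges than there are nodes without increasing its weight. -/
theorem IsWalk.exists_short [Fintype V] {s v : V} (hneg : ¬ HasNegCycleFrom src tgt w s)
    {es : List E} (h : IsWalk src tgt s v es) :
    ∃ fs, IsWalk src tgt s v fs ∧ fs.length ≤ Fintype.card V - 1 ∧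
      weight w fs ≤ weight w es := by
  induction hn : es.length using Nat.strong_induction_on generalizing es with
  | _ n ih =>
    by_cases hlen : es.length ≤ Fintype.card V - 1
    · exact ⟨es, h, hlen, le_rfl⟩
    obtain ⟨x, as, bs, cs, rfl, hbs, has, hcyc, hcs⟩ := h.exists_cycle (by omega)
    have hpos : 0 < bs.length := List.length_pos_iff.2 hbs
    have hw : 0 ≤ weight w bs := by
      by_contra! hlt
      exact hneg ⟨x, bs, hbs, hcyc, hlt, as, has⟩
    obtain ⟨fs, hfs, hl, hle⟩ := ih (as ++ cs).length (by simp at hn ⊢; omega)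
      (isWalk_append_iff.2 ⟨x, has, hcs⟩) rfl
    refine ⟨fs, hfs, hl, hle.trans ?_⟩
    simp only [weight_append]
    omega

theorem IsWalk.le_add_weight {f : V → WithTop ℤ}
    (hf : ∀ e, f (tgt e) ≤ f (src e) + (w e : WithTop ℤ)) {u v : V} {es : List E}
    (h : IsWalk src tgt u v es) : f v ≤ f u + (weight w es : WithTop ℤ) := by
  induction h with
  | nil u => simp [weight]
  | @cons v e es _ ih =>
    have hw : weight w (e :: es) = w e + weight w es := by simp [weight]
    rw [hw, WithTop.coe_add, ← add_assoc]
    exact ih.trans (by gcongr; exact hf e)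

end Walks

section Distance

variable {V E : Type*} [Fintype E] [DecidableEq V] {src tgt : E → V} {w : E → ℤ} {s : V}

theorem bfDist_antitone (v : V) : Antitone fun k => bfDist src tgt w s k v :=
  antitone_nat_of_succ_le fun _ => min_le_left _ _

theorem bfDist_succ_tgt_le (k : ℕ) (e : E) :
    bfDist src tgt w s (k + 1) (tgt e) ≤ bfDist src tgt w s k (src e) + (w e : WithTop ℤ) := by
  refine (min_le_right _ _).trans ((Finset.inf_le (Finset.mem_univ e)).trans ?_)
  simp

theorem bfDist_source_le (k : ℕ) : bfDist src tgt w s k s ≤ 0 :=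
  (bfDist_antitone s (Nat.zero_le k)).trans (by simp [bfDist])

theorem bfDist_le_weight {v : V} {es : List E} (h : IsWalk src tgt s v es) {k : ℕ}
    (hk : es.length ≤ k) : bfDist src tgt w s k v ≤ (weight w es : WithTop ℤ) := by
  refine (bfDist_antitone v hk).trans ?_
  clear hk
  induction es using List.reverseRecOn generalizing v with
  | nil =>
    obtain rfl := isWalk_nil_iff.1 h
    simp [bfDist, weight]
  | append_singleton es e ih =>
    obtain ⟨x, hx, he⟩ := isWalk_append_iff.1 h
    obtain ⟨rfl, hnil⟩ := isWalk_cons_iff.1 he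
    obtain rfl := isWalk_nil_iff.1 hnil
    rw [List.length_append, List.length_singleton]
    refine (bfDist_succ_tgt_le _ e).trans ?_
    rw [weight_append, WithTop.coe_add]
    simpa [weight] using add_le_add_left (ih hx) (w e : WithTop ℤ)

theorem exists_walk_of_bfDist_eq {k : ℕ} {v : V} {c : ℤ}
    (h : bfDist src tgt w s k v = (c : WithTop ℤ)) :
    ∃ es, IsWalk src tgt s v es ∧ weight w es = c := by
  induction k generalizing v c with
  | zero =>
    by_cases hv : v = s
    · subst hv
      refine ⟨[], .nil v, ?_⟩
      simp only [bfDist, if_true] at h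
      simpa [weight] using WithTop.coe_eq_coe.1 h
    · simp [bfDist, hv] at h
  | succ k ih =>
    simp only [bfDist] at h
    rcases min_choice (bfDist src tgt w s k v) (Finset.univ.inf fun e : E =>
      if tgt e = v then bfDist src tgt w s k (src e) + (w e : WithTop ℤ) else ⊤) with hm | hm
    · exact ih (hm.symm.trans h)
    · rw [hm] at h
      have hne : (Finset.univ : Finset E).Nonempty := by
        by_contra hempty
        simp [Finset.not_nonempty_iff_eq_empty.1 hempty] at h
      obtain ⟨e, -, he⟩ := Finset.exists_mem_eq_inf _ hne fun e : E =>
        if tgt e = v then bfDist src tgt w s k (src e) + (w e : WithTop ℤ) else ⊤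
      rw [he] at h
      split_ifs at h with hv
      · obtain ⟨a, b, ha, hb, hab⟩ := WithTop.add_eq_coe.1 h
        obtain ⟨es, hes, hwt⟩ := ih ha.symm
        refine ⟨es ++ [e], isWalk_append_iff.2 ⟨_, hes, isWalk_cons_iff.2
          ⟨rfl, isWalk_nil_iff.2 hv⟩⟩, ?_⟩
        have hb' : b = w e := WithTop.coe_eq_coe.1 hb
        rw [weight_append, hwt, ← hab, hb']
        simp [weight]
      · simp at h

end Distance

end BFPaper

/-- After `|V| - 1` Bellman-Ford iterations, some edge can still be relaxed iff
there is a negative-weight cycle reachable from the source. -/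
theorem exists_relaxable_edge_iff_negCycle
    (V E : Type*) [Fintype V] [Fintype E] [DecidableEq V]
    (src tgt : E → V) (w : E → ℤ) (s : V) :
    (∃ e : E,
        BFPaper.bfDist src tgt w s (Fintype.card V - 1) (src e) + (w e : WithTop ℤ) <
          BFPaper.bfDist src tgt w s (Fintype.card V - 1) (tgt e)) ↔
      BFPaper.HasNegCycleFrom src tgt w s := by
  open BFPaper in
  constructor
  · rintro ⟨e, he⟩
    by_contra hneg
    obtain ⟨c, hc⟩ := WithTop.ne_top_iff_exists.1 (WithTop.add_ne_top.1 he.ne_top).1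
    obtain ⟨es, hes, rfl⟩ := exists_walk_of_bfDist_eq hc.symm
    have hes' : IsWalk src tgt s (tgt e) (es ++ [e]) :=
      isWalk_append_iff.2 ⟨_, hes, .cons e (.nil _)⟩
    obtain ⟨fs, hfs, hlen, hle⟩ := hes'.exists_short hneg
    refine (he.trans_le ((bfDist_le_weight hfs hlen).trans (WithTop.coe_le_coe.2 hle))).ne ?_
    rw [← hc, weight_append, WithTop.coe_add]
    simp [weight]
  · rintro ⟨u, cs, -, hcs, hlt, es, hes⟩
    by_contra! hrelax
    have hu := (hes.le_add_weight hrelax).trans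
      (add_le_add_left (bfDist_source_le _) _)
    have hfin : bfDist src tgt w s (Fintype.card V - 1) u ≠ ⊤ := by
      rintro htop
      rw [htop, zero_add] at hu
      exact WithTop.coe_ne_top (top_le_iff.1 hu)
    obtain ⟨c, hc⟩ := WithTop.ne_top_iff_exists.1 hfin
    have hcycle := hcs.le_add_weight hrelax
    rw [← hc, ← WithTop.coe_add, WithTop.coe_le_coe] at hcycle
    omega
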